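/- (Chain rule for ∂_V via double operator sums.) Let A ∈ M_n(ℂ) be Hermitian with spectral decomposition A = Σ_i λ_i A_i, let ℓ, r : M_n(ℂ) → M_m(ℂ) be unital *-homomorphisms, let V ∈ M_m(ℂ), and define ∂_V X = V r(X) − ℓ(X) V. For any function f : spec(A) → ℝ, ∂_V f(A) = δf(ℓ(A), r(A)) # ∂_V A, where δf(λ,μ) = (f(λ)−f(μ))/(λ−μ) for λ ≠ μ (value on the diagonal irrelevant/arbitrary), δf(ℓ(A),r(A)) := Σ_{i,k} δf(λ_i,λ_k) ℓ(A_i) ⊗ r(A_k), and (X⊗Y)#C = XCY. -/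

import Mathlib

open Matrix

/-- Chain rule for `∂_V` via double operator sums: if `A = Σ_i λ_i A_i` is a spectral
decomposition of a Hermitian matrix, `ℓ, r` are unital *-homomorphisms, `V` is any matrix,
`∂_V X = V r(X) − ℓ(X) V`, and `δf` is the discrete derivative of `f` (with arbitrary
values on the diagonal), then `∂_V f(A) = δf(ℓ(A), r(A)) # ∂_V A`, i.e.
`∂_V f(A) = Σ_{i,k} δf(λ_i,λ_k) ℓ(A_i) (∂_V A) r(A_k)`. -/
theorem stmt_11 (n m : ℕ) (ι : Type*) [Fintype ι] [DecidableEq ι]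
    (A : Matrix (Fin n) (Fin n) ℂ) (hA : A.IsHermitian)
    (lam : ι → ℝ) (Ai : ι → Matrix (Fin n) (Fin n) ℂ)
    (hspec : A = ∑ i, (lam i : ℂ) • Ai i)
    (hproj : ∀ i k, Ai i * Ai k = if i = k then Ai i else 0)
    (hsum : ∑ i, Ai i = 1)
    (l r : Matrix (Fin n) (Fin n) ℂ →⋆ₐ[ℂ] Matrix (Fin m) (Fin m) ℂ)
    (V : Matrix (Fin m) (Fin m) ℂ)
    (f : ℝ → ℝ) (df : ℝ → ℝ → ℝ)
    (hdf : ∀ x y, x ≠ y → df x y = (f x - f y) / (x - y)) :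
    V * r (∑ i, (f (lam i) : ℂ) • Ai i) - l (∑ i, (f (lam i) : ℂ) • Ai i) * V
      = ∑ i, ∑ k, (df (lam i) (lam k) : ℂ) • (l (Ai i) * (V * r A - l A * V) * r (Ai k)) := by
  have hl1 : ∑ i, l (Ai i) = 1 := by rw [← map_sum, hsum, map_one]
  have hr1 : ∑ i, r (Ai i) = 1 := by rw [← map_sum, hsum, map_one]
  have hAi : ∀ i, Ai i * A = (lam i : ℂ) • Ai i := by
    intro i
    rw [hspec, Finset.mul_sum]
    simp [hproj]
  have hAk : ∀ k, A * Ai k = (lam k : ℂ) • Ai k := by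
    intro k
    rw [hspec, Finset.sum_mul]
    simp [hproj]
  have hterm : ∀ i k, (df (lam i) (lam k) : ℂ) • (l (Ai i) * (V * r A - l A * V) * r (Ai k))
      = (f (lam k) : ℂ) • (l (Ai i) * V * r (Ai k))
        - (f (lam i) : ℂ) • (l (Ai i) * V * r (Ai k)) := by
    intro i k
    have h1 : l (Ai i) * (V * r A - l A * V) * r (Ai k)
        = ((lam k : ℂ) - (lam i : ℂ)) • (l (Ai i) * V * r (Ai k)) := by
      have e : l (Ai i) * (V * r A - l A * V) * r (Ai k)
        = l (Ai i) * V * (r A * r (Ai k)) - (l (Ai i) * l A) * V * r (Ai k) := by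
        noncomm_ring
      rw [e, ← map_mul, ← map_mul, hAi, hAk, map_smul, map_smul, sub_smul]
      simp only [Matrix.mul_smul, Matrix.smul_mul]
    rw [h1, smul_smul, ← sub_smul]
    congr 1
    by_cases h : lam i = lam k
    · simp [h]
    · rw [hdf _ _ h]
      have h2 : (lam i : ℂ) - (lam k : ℂ) ≠ 0 := by
        rw [sub_ne_zero]; exact_mod_cast h
      push_cast
      field_simp
      ring
  simp only [hterm, Finset.sum_sub_distrib]
  congr 1
  · rw [Finset.sum_comm, map_sum, Finset.mul_sum]
    refine Finset.sum_congr rfl fun k _ => ?_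
    rw [← Finset.smul_sum, ← Finset.sum_mul, ← Finset.sum_mul, hl1, one_mul, map_smul,
      Matrix.mul_smul]
  · rw [map_sum, Finset.sum_mul]
    refine Finset.sum_congr rfl fun k _ => ?_
    rw [← Finset.smul_sum, ← Finset.mul_sum, hr1, mul_one, map_smul, Matrix.smul_mul]
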